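/- Fix an integer M ≥ 1, a real constant c, and integers x_i, x_{j₁}, x_{j₂}; set θ_k = 2π x_k / M. Define the 7-dimensional vectors q = (c cos θ_i, c sin θ_i, 0, −c sin θ_i, c cos θ_i, 0, c), k = (sin θ_{j₁}, cos θ_{j₁}, 0, −sin θ_{j₁}, −cos θ_{j₁}, 0, 0), and k' = (0, 0, cos θ_{j₂}, 0, 0, −sin θ_{j₂}, 0). Then the sum-of-determinants attention score det([q[1:3], k[1:3], k'[1:3]]) + det([q[4:6], k[4:6], k'[4:6]]) equals c · cos(2π(x_i + x_{j₁} + x_{j₂})/M), where v[a:b] denotes the subvector of coordinates a through b and [u,v,w] the 3×3 matrix with rows u, v, w. -/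

import Mathlib

open Matrix Real

/-- The first chunk `v[1:3]` of a vector `v ∈ ℝ⁷` (coordinates 1–3, zero-indexed 0–2). -/
def chunk1 (v : Fin 7 → ℝ) : Fin 3 → ℝ := ![v 0, v 1, v 2]

/-- The second chunk `v[4:6]` of a vector `v ∈ ℝ⁷` (coordinates 4–6, zero-indexed 3–5). -/
def chunk2 (v : Fin 7 → ℝ) : Fin 3 → ℝ := ![v 3, v 4, v 5]

/-- The sum-of-determinants attention score of the paper's 7-dimensional embeddings
equals `c · cos(2π(xᵢ + x_{j₁} + x_{j₂})/M)`. -/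
theorem score_eq_cos (M : ℕ) (hM : 1 ≤ M) (c : ℝ) (xi xj1 xj2 : ℤ) :
    let θi : ℝ := 2 * π * xi / M
    let θj1 : ℝ := 2 * π * xj1 / M
    let θj2 : ℝ := 2 * π * xj2 / M
    let q : Fin 7 → ℝ :=
      ![c * Real.cos θi, c * Real.sin θi, 0, -c * Real.sin θi, c * Real.cos θi, 0, c]
    let k : Fin 7 → ℝ :=
      ![Real.sin θj1, Real.cos θj1, 0, -Real.sin θj1, -Real.cos θj1, 0, 0]
    let k' : Fin 7 → ℝ :=
      ![0, 0, Real.cos θj2, 0, 0, -Real.sin θj2, 0]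
    (Matrix.of ![chunk1 q, chunk1 k, chunk1 k']).det
        + (Matrix.of ![chunk2 q, chunk2 k, chunk2 k']).det
      = c * Real.cos (2 * π * ((xi : ℝ) + (xj1 : ℝ) + (xj2 : ℝ)) / M) := by
  intro θi θj1 θj2 q k k'
  have h : 2 * π * ((xi : ℝ) + (xj1 : ℝ) + (xj2 : ℝ)) / M = θi + θj1 + θj2 := by
    simp only [θi, θj1, θj2]
    ring
  rw [h, Real.cos_add, Real.cos_add, Real.sin_add]
  clear_value θi θj1 θj2
  simp [Matrix.det_fin_three, chunk1, chunk2, q, k, k']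
  ring
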